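/- Let (Ω, F, P) be a probability space, V : Ω → ℝ^k a measurable random vector (the observed covariates on a missing pattern), ξ : Ω → ℝ^l a random vector independent of V, C an l×k real matrix and d₀ ∈ ℝ^l, and define X_mis := C·V + d₀ + ξ. Let β₀ ∈ ℝ, β_obs ∈ ℝ^k, β_mis ∈ ℝ^l, and suppose ⟨β_mis, ξ⟩ is Gaussian with mean 0 and variance σ̃² > 0. Then, P-almost surely, |E[σ(β₀ + ⟨β_obs, V⟩ + ⟨β_mis, X_mis⟩) | σ(V)] − σ((α₀ + ⟨α, V⟩)/√(1 + (π/8)σ̃²))| ≤ 2·‖δ‖_∞, where α₀ = β₀ + ⟨β_mis, d₀⟩ and α = β_obs + Cᵀβ_mis. -/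

import Mathlib

open MeasureTheory ProbabilityTheory Real Matrix
open scoped NNReal

/-- The standard normal CDF `Φ(t) = (2π)^{-1/2} ∫_{-∞}^t e^{-s²/2} ds`. -/
noncomputable def stdNormalCDF (t : ℝ) : ℝ :=
  ∫ s in Set.Iic t, Real.exp (-s ^ 2 / 2) / Real.sqrt (2 * Real.pi)

/-- The logistic (sigmoid) function `σ(t) = 1/(1 + e^{-t})`. -/
noncomputable def logisticFn (t : ℝ) : ℝ := 1 / (1 + Real.exp (-t))

/-- `δ(t) = Φ(t) − σ(√(8/π)·t)`. -/
noncomputable def deltaFn (t : ℝ) : ℝ :=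
  stdNormalCDF t - logisticFn (Real.sqrt (8 / Real.pi) * t)

lemma logisticFn_mem (t : ℝ) : 0 ≤ logisticFn t ∧ logisticFn t ≤ 1 := by
  unfold logisticFn
  have := Real.exp_pos (-t)
  constructor
  · positivity
  · rw [div_le_one (by positivity)]; linarith

lemma measurable_logisticFn : Measurable logisticFn := by
  unfold logisticFn
  fun_prop

lemma stdNormalCDF_eq (t : ℝ) : stdNormalCDF t = (gaussianReal 0 1).real (Set.Iic t) := by
  rw [measureReal_def, gaussianReal_apply_eq_integral 0 one_ne_zero, ENNReal.toReal_ofReal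
    (integral_nonneg (fun x => gaussianPDFReal_nonneg _ _ _))]
  unfold stdNormalCDF
  congr 1 with x
  simp [gaussianPDFReal, div_eq_inv_mul]

lemma stdNormalCDF_mem (t : ℝ) : 0 ≤ stdNormalCDF t ∧ stdNormalCDF t ≤ 1 := by
  rw [stdNormalCDF_eq]
  exact ⟨measureReal_nonneg, measureReal_le_one⟩

lemma measurable_stdNormalCDF : Measurable stdNormalCDF := by
  apply Monotone.measurable
  intro a b h
  rw [stdNormalCDF_eq, stdNormalCDF_eq]
  exact measureReal_mono (Set.Iic_subset_Iic.2 h)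

lemma measurable_deltaFn : Measurable deltaFn := by
  unfold deltaFn
  exact measurable_stdNormalCDF.sub (measurable_logisticFn.comp (by fun_prop))

lemma abs_deltaFn_le_one (t : ℝ) : |deltaFn t| ≤ 1 := by
  unfold deltaFn
  have h1 := stdNormalCDF_mem t
  have h2 := logisticFn_mem (Real.sqrt (8 / Real.pi) * t)
  rw [abs_le]; constructor <;> linarith [h1.1, h1.2, h2.1, h2.2]

lemma abs_deltaFn_le (t : ℝ) : |deltaFn t| ≤ ⨆ t : ℝ, |deltaFn t| :=
  le_ciSup (f := fun t => |deltaFn t|) ⟨1, by rintro _ ⟨t, rfl⟩; exact abs_deltaFn_le_one t⟩ t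

lemma gaussian_Iic (v : ℝ≥0) (hv : 0 < v) (t : ℝ) :
    (gaussianReal 0 v).real (Set.Iic t) = stdNormalCDF (t / √(v : ℝ)) := by
  have hs : 0 < √(v : ℝ) := Real.sqrt_pos.2 hv
  have h := gaussianReal_map_const_mul (μ := 0) (v := 1) (√(v : ℝ))
  have e : gaussianReal 0 v = (gaussianReal 0 1).map (√(v : ℝ) * ·) := by
    rw [h, mul_zero, mul_one]
    congr 1
    ext
    simp
  rw [e, stdNormalCDF_eq, map_measureReal_apply (by fun_prop) measurableSet_Iic]
  congr 1
  ext x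
  simp [le_div_iff₀' hs]

lemma integral_stdNormalCDF (v : ℝ≥0) (c m : ℝ) :
    ∫ x, stdNormalCDF (c * (m + x)) ∂(gaussianReal 0 v)
      = stdNormalCDF (c * m / √(1 + c ^ 2 * v)) := by
  set w : ℝ≥0 := .mk (c ^ 2) (sq_nonneg c) * v + 1 with hw
  have hw0 : 0 < w := by positivity
  have hwc : (w : ℝ) = 1 + c ^ 2 * v := by rw [hw]; push_cast; rw [add_comm]
  have hmap : (gaussianReal 0 v).map (-c * ·) =
      gaussianReal 0 (.mk (c ^ 2) (sq_nonneg c) * v) := by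
    rw [gaussianReal_map_const_mul, mul_zero]
    congr 2
    ext; simp
  have hconv := gaussianReal_conv_gaussianReal (m₁ := 0) (m₂ := 0)
    (v₁ := .mk (c ^ 2) (sq_nonneg c) * v) (v₂ := 1)
  rw [add_zero, ← hw] at hconv
  have hF : Measurable fun x : ℝ => ∫⁻ y, (Set.Iic (c * m)).indicator (1 : ℝ → ENNReal) (x + y)
      ∂(gaussianReal 0 1) := by
    apply Measurable.lintegral_prod_right' (f := fun p : ℝ × ℝ =>
      (Set.Iic (c * m)).indicator (1 : ℝ → ENNReal) (p.1 + p.2))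
    exact (measurable_one.indicator measurableSet_Iic).comp (by fun_prop)
  rw [← hwc, ← gaussian_Iic w hw0, ← hconv, ← hmap, measureReal_def,
    ← lintegral_indicator_one measurableSet_Iic,
    Measure.lintegral_conv (measurable_one.indicator measurableSet_Iic),
    lintegral_map hF (by fun_prop)]
  rw [← integral_toReal]
  · congr 1 with x
    rw [stdNormalCDF_eq, measureReal_def, ← lintegral_indicator_one measurableSet_Iic]
    congr 2 with y
    simp only [Set.indicator, Set.mem_Iic]
    congr 1
    apply propext
    constructor <;> intro h <;> linarith
  · exact (hF.comp (by fun_prop : Measurable fun x : ℝ => -c * x)).aemeasurable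
  · refine ae_of_all _ fun x => ?_
    refine lt_of_le_of_lt (lintegral_mono (g := fun _ => 1) fun y => ?_) (by simp)
    exact Set.indicator_le_self' (by simp) _

lemma logistic_eq (t : ℝ) :
    logisticFn t = stdNormalCDF (√(π / 8) * t) - deltaFn (√(π / 8) * t) := by
  have : √(8 / π) * √(π / 8) = 1 := by
    rw [← Real.sqrt_mul (by positivity)]
    have : 8 / π * (π / 8) = 1 := by field_simp
    simp [this]
  unfold deltaFn
  rw [← mul_assoc, this]
  simp

lemma key (v : ℝ≥0) (m : ℝ) :
    |∫ x, logisticFn (m + x) ∂(gaussianReal 0 v) - logisticFn (m / √(1 + π / 8 * v))| ≤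
      2 * ⨆ t : ℝ, |deltaFn t| := by
  have h1 := integral_stdNormalCDF v (√(π / 8)) m
  rw [Real.sq_sqrt (by positivity)] at h1
  have i1 : Integrable (fun x => stdNormalCDF (√(π / 8) * (m + x))) (gaussianReal 0 v) := by
    refine Integrable.of_bound (measurable_stdNormalCDF.comp
      (by fun_prop)).aestronglyMeasurable 1 (ae_of_all _ fun x => ?_)
    rw [Real.norm_eq_abs, abs_of_nonneg (stdNormalCDF_mem _).1]
    exact (stdNormalCDF_mem _).2
  have i2 : Integrable (fun x => deltaFn (√(π / 8) * (m + x))) (gaussianReal 0 v) :=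
    Integrable.of_bound (measurable_deltaFn.comp
      (by fun_prop)).aestronglyMeasurable 1 (ae_of_all _ fun x => abs_deltaFn_le_one _)
  have h2 : ∫ x, logisticFn (m + x) ∂(gaussianReal 0 v) =
      ∫ x, (stdNormalCDF (√(π / 8) * (m + x)) - deltaFn (√(π / 8) * (m + x)))
        ∂(gaussianReal 0 v) := by
    congr 1 with x
    exact logistic_eq _
  rw [h2, integral_sub i1 i2, h1, logistic_eq (m / _), ← mul_div_assoc]
  have h3 : |∫ x, deltaFn (√(π / 8) * (m + x)) ∂(gaussianReal 0 v)| ≤ ⨆ t : ℝ, |deltaFn t| := by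
    have := norm_integral_le_of_norm_le_const (μ := gaussianReal 0 v)
      (f := fun x => deltaFn (√(π / 8) * (m + x)))
      (ae_of_all _ fun x => abs_deltaFn_le (√(π / 8) * (m + x)))
    simpa using this
  have h4 := abs_deltaFn_le (√(π / 8) * m / √(1 + π / 8 * v))
  rw [abs_le] at h3 h4 ⊢
  constructor <;> linarith [h3.1, h3.2, h4.1, h4.2]

/-- Theorem 2 of the paper in regression-residual form: if `X_mis = C V + d₀ + ξ` with `ξ`
independent of the observed covariates `V` and `⟨β_mis, ξ⟩ ~ N(0, σ̃²)`, `σ̃² > 0`, then a.s.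
`|E[σ(β₀ + ⟨β_obs, V⟩ + ⟨β_mis, X_mis⟩) | σ(V)] − σ((α₀ + ⟨α, V⟩)/√(1 + (π/8)σ̃²))| ≤ 2‖δ‖_∞`,
where `α₀ = β₀ + ⟨β_mis, d₀⟩` and `α = β_obs + Cᵀ β_mis`. -/
theorem logistic_pattern_by_pattern {Ω : Type*} [MeasurableSpace Ω]
    (P : Measure Ω) [IsProbabilityMeasure P] (k l : ℕ)
    (V : Ω → (Fin k → ℝ)) (hV : Measurable V)
    (ξ : Ω → (Fin l → ℝ)) (hξ : Measurable ξ)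
    (hindep : IndepFun V ξ P)
    (C : Matrix (Fin l) (Fin k) ℝ) (d₀ : Fin l → ℝ)
    (Xmis : Ω → (Fin l → ℝ)) (hXmis : ∀ ω, Xmis ω = C.mulVec (V ω) + d₀ + ξ ω)
    (β₀ : ℝ) (βobs : Fin k → ℝ) (βmis : Fin l → ℝ)
    (σt2 : ℝ≥0) (hσt2 : 0 < σt2)
    (hgauss : P.map (fun ω => βmis ⬝ᵥ ξ ω) = gaussianReal 0 σt2) :
    ∀ᵐ ω ∂P,
      |(P[fun ω => logisticFn (β₀ + βobs ⬝ᵥ V ω + βmis ⬝ᵥ Xmis ω) |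
            MeasurableSpace.comap V inferInstance]) ω -
          logisticFn (((β₀ + βmis ⬝ᵥ d₀) + (βobs + C.transpose.mulVec βmis) ⬝ᵥ V ω) /
            Real.sqrt (1 + (Real.pi / 8) * (σt2 : ℝ)))| ≤
        2 * ⨆ t : ℝ, |deltaFn t| := by
  classical
  set Y : Ω → ℝ := fun ω => βmis ⬝ᵥ ξ ω with hYdef
  have hdot : ∀ n (b : Fin n → ℝ), Measurable (fun x : Fin n → ℝ => b ⬝ᵥ x) := by
    intro n b
    unfold dotProduct
    fun_prop
  have hY : Measurable Y := (hdot l βmis).comp hξ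
  have hind : IndepFun V Y P := hindep.comp measurable_id (hdot l βmis)
  set M : (Fin k → ℝ) → ℝ :=
    fun v => (β₀ + βmis ⬝ᵥ d₀) + (βobs + C.transpose.mulVec βmis) ⬝ᵥ v with hM
  have hMm : Measurable M := (hdot k _).const_add _
  have hfun : (fun ω => logisticFn (β₀ + βobs ⬝ᵥ V ω + βmis ⬝ᵥ Xmis ω)) =
      fun ω => (fun p : (Fin k → ℝ) × ℝ => logisticFn (M p.1 + p.2)) (V ω, Y ω) := by
    funext ω
    simp only [hM, hYdef, hXmis, dotProduct_add, add_dotProduct, Matrix.mulVec_transpose,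
      Matrix.dotProduct_mulVec]
    congr 1
    ring
  have hfm : Measurable (fun p : (Fin k → ℝ) × ℝ => logisticFn (M p.1 + p.2)) :=
    measurable_logisticFn.comp (by fun_prop)
  have hce := condExp_prod_ae_eq_integral_condDistrib (μ := P) hV hY.aemeasurable
    hfm.stronglyMeasurable (Integrable.of_bound
      (hfm.comp (hV.prodMk hY)).aestronglyMeasurable 1 (ae_of_all _ fun ω => by
        have := logisticFn_mem (M (V ω) + Y ω)
        simpa [abs_of_nonneg this.1] using this.2))
  have hcd : condDistrib Y V P =ᵐ[P.map V] Kernel.const _ (gaussianReal 0 σt2) := by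
    rw [condDistrib_ae_eq_iff_measure_eq_compProd V hY.aemeasurable, Measure.compProd_const,
      ← hgauss]
    exact (indepFun_iff_map_prod_eq_prod_map_map hV.aemeasurable hY.aemeasurable).1 hind
  have hcd' := ae_of_ae_map hV.aemeasurable hcd
  rw [hfun]
  filter_upwards [hce, hcd'] with ω h1 h2
  rw [h1, h2, Kernel.const_apply]
  exact key σt2 (M (V ω))
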